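/- Let n ≥ 1, let B be an invertible real n×n matrix, let L = B(ℤⁿ) be the lattice of periods, L' = {ξ ∈ ℝⁿ : ξ·e ∈ ℤ for all e ∈ L} the dual lattice, and F = B([0,1)ⁿ) a fundamental domain. Let φ : ℝ → ℝⁿ be continuous and suppose there exist ξ ∈ L' with ξ ≠ 0 and constants α, β, I ∈ ℝ and δ > 0 such that ξ·φ(λ) = αλ + β for all λ ∈ [I − δ, I + δ]. Define u(t, x) = I + δ sin(2π(ξ·x − α t)). Then: (a) u is an entropy solution of u_t + div_x φ(u) = 0 on Π = (0, ∞) × ℝⁿ; (b) for every e ∈ L and all (t, x), u(t, x + e) = u(t, x), and (1/|det B|) ∫_F u(t, x) dx = I for every t > 0; (c) ∫_F |u(t, x) − I| dx = (2/π) δ |det B| for every t > 0; in particular ∫_F |u(t, x) − I| dx does not tend to 0 as t → +∞. -/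

import Mathlib

open MeasureTheory Filter

/-- A bounded measurable `u` on `Π = (0,∞) × ℝⁿ` is an entropy solution of
`u_t + div_x φ(u) = 0` if for every `k ∈ ℝ` and every nonnegative `C¹` function `f`
compactly supported in `Π`,
`∫_Π (|u−k| ∂_t f + sgn(u−k) (φ(u)−φ(k))·∇_x f) ≥ 0`.
Here `∂_t f (z) = Df(z)(1,0)` and `(φ(u)−φ(k))·∇_x f (z) = Df(z)(0, φ(u(z))−φ(k))`. -/
def IsEntropySolution (n : ℕ) (φ : ℝ → Fin n → ℝ) (u : ℝ × (Fin n → ℝ) → ℝ) : Prop :=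
  ∀ k : ℝ, ∀ f : ℝ × (Fin n → ℝ) → ℝ, ContDiff ℝ 1 f → HasCompactSupport f →
    tsupport f ⊆ Set.Ioi (0 : ℝ) ×ˢ Set.univ → (∀ z, 0 ≤ f z) →
    0 ≤ ∫ z in Set.Ioi (0 : ℝ) ×ˢ (Set.univ : Set (Fin n → ℝ)),
        (|u z - k| * fderiv ℝ f z (1, 0) +
          Real.sign (u z - k) * fderiv ℝ f z (0, fun i => φ (u z) i - φ k i))

/-- Integration by parts in a direction of invariance. -/
lemma aux_dir {n : ℕ} (f h : ℝ × (Fin n → ℝ) → ℝ) (w : ℝ × (Fin n → ℝ))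
    (hf : ContDiff ℝ 1 f) (hc : HasCompactSupport f) (hh : Continuous h)
    (hw : ∀ z, ∀ t : ℝ, h (z + t • w) = h z) :
    Integrable (fun z => h z * fderiv ℝ f z w) ∧ ∫ z, h z * fderiv ℝ f z w = 0 := by
  have hcont : Continuous fun z => fderiv ℝ f z w :=
    (hf.continuous_fderiv (by norm_num)).clm_apply continuous_const
  have hcs : HasCompactSupport fun z => fderiv ℝ f z w := hc.fderiv_apply (𝕜 := ℝ) w
  have hi : Integrable (fun z => h z * fderiv ℝ f z w) :=
    (hh.mul hcont).integrable_of_hasCompactSupport hcs.mul_left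
  have hi2 : Integrable (fun z => h z * f z) :=
    (hh.mul hf.continuous).integrable_of_hasCompactSupport hc.mul_left
  refine ⟨hi, ?_⟩
  haveI : (volume : Measure (ℝ × (Fin n → ℝ))).IsAddHaarMeasure := by
    rw [Measure.volume_eq_prod]; infer_instance
  have := integral_bilinear_hasLineDerivAt_right_eq_neg_left_of_integrable
    (μ := (volume : Measure (ℝ × (Fin n → ℝ)))) (f := h) (f' := fun _ => 0) (g := f)
    (g' := fun z => fderiv ℝ f z w) (v := w) (B := ContinuousLinearMap.mul ℝ ℝ)
    (by simp) (by simpa using hi) (by simpa using hi2)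
    (fun x _ => by
      have : (fun t : ℝ => h (x + t • w)) = fun _ => h x := funext (hw x)
      unfold HasLineDerivAt
      rw [this]
      exact hasDerivAt_const _ _)
    (fun x _ => ((hf.differentiable (by norm_num)) x).hasFDerivAt.hasLineDerivAt w)
  simpa using this

lemma aux_div {n : ℕ} (f : ℝ × (Fin n → ℝ) → ℝ) (hf : ContDiff ℝ 1 f) (hc : HasCompactSupport f)
    (ξ : Fin n → ℝ) (hξ0 : ξ ≠ 0) (α c : ℝ) (a : ℝ → ℝ) (G : ℝ → Fin n → ℝ)
    (ha : Continuous a) (hG : Continuous G) (hac : ∀ s, ∑ i, ξ i * G s i - α * a s = c) :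
    ∫ z : ℝ × (Fin n → ℝ), (a ((∑ i, ξ i * z.2 i) - α * z.1) * fderiv ℝ f z (1, 0) +
      fderiv ℝ f z (0, G ((∑ i, ξ i * z.2 i) - α * z.1))) = 0 := by
  obtain ⟨i0, hi0⟩ : ∃ i, ξ i ≠ 0 := by
    by_contra! h
    exact hξ0 (funext h)
  set ℓ : ℝ × (Fin n → ℝ) → ℝ := fun z => (∑ i, ξ i * z.2 i) - α * z.1 with hℓ
  have hℓc : Continuous ℓ := by fun_prop
  set p : ℝ × (Fin n → ℝ) := (0, Pi.single i0 (1 / ξ i0)) with hp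
  have hℓadd : ∀ z w, ∀ t : ℝ, ℓ (z + t • w) = ℓ z + t * ℓ w := by
    intro z w t
    simp only [hℓ, Prod.snd_add, Prod.fst_add, Prod.smul_snd, Prod.smul_fst, Pi.add_apply,
      Pi.smul_apply, smul_eq_mul, mul_add, Finset.sum_add_distrib, mul_sub, Finset.mul_sum]
    have : ∑ i, ξ i * (t * w.2 i) = ∑ i, t * (ξ i * w.2 i) :=
      Finset.sum_congr rfl fun i _ => by ring
    rw [this]; ring
  have hℓp : ℓ p = 1 := by
    simp [hℓ, hp, Pi.single_apply, hi0]
  have hadd : ∀ z w, ℓ (z + w) = ℓ z + ℓ w := fun z w => by simpa using hℓadd z w 1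
  set w0 : ℝ × (Fin n → ℝ) := (1, 0) + α • p with hw0
  set w : Fin n → ℝ × (Fin n → ℝ) := fun i => (0, Pi.single i 1) + (-ξ i) • p with hw
  have hℓw0 : ℓ w0 = 0 := by
    rw [hw0, hℓadd, hℓp]; simp [hℓ]
  have hℓw : ∀ i, ℓ (w i) = 0 := by
    intro i
    rw [hw, hℓadd, hℓp]; simp [hℓ, Pi.single_apply]
  have key : ∀ z, a (ℓ z) * fderiv ℝ f z (1, 0) + fderiv ℝ f z (0, G (ℓ z)) =
      a (ℓ z) * fderiv ℝ f z w0 + (∑ i, G (ℓ z) i * fderiv ℝ f z (w i))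
        + c * fderiv ℝ f z p := by
    intro z
    have h1 : ((0, G (ℓ z)) : ℝ × (Fin n → ℝ)) =
        ∑ i, G (ℓ z) i • ((0, Pi.single i 1) : ℝ × (Fin n → ℝ)) := by
      ext j
      · simp [Prod.fst_sum]
      · simp [Prod.snd_sum, Finset.sum_apply, Pi.single_apply]
    rw [h1, map_sum, ← hac (ℓ z)]
    simp only [hw0, hw, map_add, map_smul, smul_eq_mul, mul_add, Finset.sum_add_distrib]
    have : ∑ i, G (ℓ z) i * (-ξ i * fderiv ℝ f z p) =
        - ((∑ i, ξ i * G (ℓ z) i) * fderiv ℝ f z p) := by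
      rw [Finset.sum_mul, ← Finset.sum_neg_distrib]
      exact Finset.sum_congr rfl fun i _ => by ring
    rw [this]; ring
  have A := aux_dir f (fun z => a (ℓ z)) w0 hf hc (ha.comp hℓc)
    (fun z t => by simp only [hℓadd, hℓw0, mul_zero, add_zero])
  have Bi := fun i => aux_dir f (fun z => G (ℓ z) i) (w i) hf hc
    (((continuous_apply i).comp hG).comp hℓc)
    (fun z t => by simp only [hℓadd, hℓw, mul_zero, add_zero])
  have C := aux_dir f (fun _ => c) p hf hc continuous_const (fun _ _ => rfl)
  have hsum : Integrable (fun z => ∑ i, G (ℓ z) i * fderiv ℝ f z (w i)) :=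
    integrable_finsetSum _ fun i _ => (Bi i).1
  calc _ = ∫ z, (a (ℓ z) * fderiv ℝ f z w0 + (∑ i, G (ℓ z) i * fderiv ℝ f z (w i))
        + c * fderiv ℝ f z p) := integral_congr_ae (Eventually.of_forall key)
    _ = 0 := by
      have hA : Integrable (fun z => a (ℓ z) * fderiv ℝ f z w0 +
        (∑ i, G (ℓ z) i * fderiv ℝ f z (w i))) := A.1.add hsum
      rw [integral_add hA C.1, integral_add A.1 hsum,
        integral_finsetSum _ fun i _ => (Bi i).1, A.2, C.2]
      simp [fun i => (Bi i).2]

lemma aux_sign (ψ : ℝ → ℝ) (k l : ℝ) :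
    Real.sign (l - k) * (ψ l - ψ k) = ψ (max l k) - ψ (min l k) := by
  rcases lt_trichotomy l k with h | h | h
  · rw [Real.sign_of_neg (by linarith), max_eq_right h.le, min_eq_left h.le]; ring
  · subst h; simp
  · rw [Real.sign_of_pos (by linarith), max_eq_left h.le, min_eq_right h.le]; ring

lemma aux_entropy {n : ℕ} (φ : ℝ → Fin n → ℝ) (hφ : Continuous φ)
    (ξ : Fin n → ℝ) (hξ0 : ξ ≠ (0 : Fin n → ℝ))
    (α β I δ : ℝ) (hδ : 0 < δ)
    (haff : ∀ l ∈ Set.Icc (I - δ) (I + δ), ∑ i, ξ i * φ l i = α * l + β) :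
    IsEntropySolution n φ
      (fun z => I + δ * Real.sin (2 * Real.pi * ((∑ i, ξ i * z.2 i) - α * z.1))) := by
  intro k f hf hc hsupp _
  rw [setIntegral_eq_integral_of_forall_compl_eq_zero]
  swap
  · intro z hz
    have : fderiv ℝ f z = 0 := by
      by_contra h
      exact hz (hsupp (support_fderiv_subset ℝ h))
    simp [this]
  set v : ℝ → ℝ := fun s => I + δ * Real.sin (2 * Real.pi * s) with hv
  have hvc : Continuous v := by fun_prop
  have hvm : ∀ s, v s ∈ Set.Icc (I - δ) (I + δ) := by
    intro s
    have h1 := Real.sin_le_one (2 * Real.pi * s)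
    have h2 := Real.neg_one_le_sin (2 * Real.pi * s)
    constructor <;> simp only [hv] <;> nlinarith
  set G : ℝ → Fin n → ℝ := fun s i => Real.sign (v s - k) * (φ (v s) i - φ k i) with hG
  have hGc : Continuous G := by
    refine continuous_pi fun i => ?_
    have : (fun s => G s i) = fun s => φ (max (v s) k) i - φ (min (v s) k) i :=
      funext fun s => aux_sign (fun l => φ l i) k (v s)
    rw [this]
    have hφi : Continuous fun l => φ l i := (continuous_apply i).comp hφ
    exact (hφi.comp (hvc.max continuous_const)).sub (hφi.comp (hvc.min continuous_const))
  have hGs : ∀ s, ∑ i, ξ i * G s i =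
      Real.sign (v s - k) * (α * v s + β - ∑ i, ξ i * φ k i) := by
    intro s
    rw [← haff _ (hvm s), ← Finset.sum_sub_distrib, Finset.mul_sum]
    exact Finset.sum_congr rfl fun i _ => by simp only [hG]; ring
  have hconst : ∃ c, ∀ s, ∑ i, ξ i * G s i - α * |v s - k| = c := by
    by_cases h1 : k < I - δ
    · refine ⟨α * k + β - ∑ i, ξ i * φ k i, fun s => ?_⟩
      have : 0 < v s - k := by linarith [(hvm s).1]
      rw [hGs, Real.sign_of_pos this, abs_of_pos this]; ring
    by_cases h2 : I + δ < k
    · refine ⟨-(α * k + β - ∑ i, ξ i * φ k i), fun s => ?_⟩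
      have : v s - k < 0 := by linarith [(hvm s).2]
      rw [hGs, Real.sign_of_neg this, abs_of_neg this]; ring
    refine ⟨0, fun s => ?_⟩
    rw [hGs, haff k ⟨not_lt.1 h1, not_lt.1 h2⟩]
    rcases lt_trichotomy (v s - k) 0 with h | h | h
    · rw [Real.sign_of_neg h, abs_of_neg h]; ring
    · rw [h]; simp
    · rw [Real.sign_of_pos h, abs_of_pos h]; ring
  obtain ⟨c, hcc⟩ := hconst
  have := aux_div f hf hc ξ hξ0 α c (fun s => |v s - k|) G (hvc.sub continuous_const).abs hGc hcc
  refine (Eq.trans ?_ this).ge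
  refine integral_congr_ae (Eventually.of_forall fun z => ?_)
  simp only
  congr 1
  rw [← smul_eq_mul, ← map_smul]
  congr 1
  ext j <;> simp [hG, hv]

/-- One-dimensional averaging of a periodic function. -/
lemma aux_one (g : ℝ → ℝ) (hg : Continuous g) (hp : Function.Periodic g 1) (m : ℤ) (hm : m ≠ 0)
    (d : ℝ) : ∫ y in Set.Ico (0 : ℝ) 1, g (m * y + d) = ∫ y in (0 : ℝ)..1, g y := by
  have hm' : (m : ℝ) ≠ 0 := by exact_mod_cast hm
  rw [integral_Ico_eq_integral_Ioc, ← intervalIntegral.integral_of_le zero_le_one,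
    intervalIntegral.integral_comp_mul_add _ hm']
  have := hp.intervalIntegral_add_zsmul_eq m d (fun _ _ => hg.intervalIntegrable _ _)
  rw [hp.intervalIntegral_add_eq d 0] at this
  simp only [zsmul_eq_mul, mul_one, zero_add] at this
  simp only [mul_zero, zero_add, mul_one]
  rw [add_comm (m : ℝ) d, this, smul_eq_mul]
  field_simp

lemma aux_cube {n : ℕ} (g : ℝ → ℝ) (hg : Continuous g) (hp : Function.Periodic g 1)
    (m : Fin n → ℤ) (hm : m ≠ 0) (d : ℝ) :
    ∫ y in Set.univ.pi fun _ : Fin n => Set.Ico (0 : ℝ) 1, g (∑ i, (m i : ℝ) * y i + d)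
      = ∫ y in (0 : ℝ)..1, g y := by
  obtain ⟨i0, hi0⟩ : ∃ i, m i ≠ 0 := by
    by_contra! h
    exact hm (funext h)
  cases n with
  | zero => exact i0.elim0
  | succ N =>
    let e := (MeasurableEquiv.piFinSuccAbove (fun _ : Fin (N + 1) => ℝ) i0).symm
    have hem : MeasurePreserving e :=
      (volume_preserving_piFinSuccAbove (fun _ : Fin (N + 1) => ℝ) i0).symm _
    have he : ∀ z, e z = i0.insertNth z.1 z.2 := fun z => rfl
    have hpre : e ⁻¹' (Set.univ.pi fun _ => Set.Ico (0 : ℝ) 1) =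
        Set.Ico (0 : ℝ) 1 ×ˢ (Set.univ.pi fun _ : Fin N => Set.Ico (0 : ℝ) 1) := by
      ext z
      simp only [Set.mem_preimage, Set.mem_univ_pi, he, Set.mem_prod]
      rw [Fin.forall_iff_succAbove i0]
      simp
    rw [← hem.map_eq, setIntegral_map_equiv, hpre]
    have hsum : ∀ z, ∑ i, (m i : ℝ) * e z i + d
        = m i0 * z.1 + (∑ j, (m (i0.succAbove j) : ℝ) * z.2 j + d) := by
      intro z
      rw [Fin.sum_univ_succAbove _ i0]
      simp [he, add_assoc]
    simp only [hsum]
    rw [Measure.volume_eq_prod, ← Measure.prod_restrict, integral_prod_symm]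
    · simp only [aux_one g hg hp _ hi0]
      rw [setIntegral_const]
      simp [Measure.real, volume_pi_pi]
    · rw [Measure.prod_restrict]
      have hK : IsCompact (Set.Icc (0 : ℝ) 1 ×ˢ (Set.univ.pi fun _ : Fin N => Set.Icc (0 : ℝ) 1)) :=
        isCompact_Icc.prod (isCompact_univ_pi fun _ => isCompact_Icc)
      refine (ContinuousOn.integrableOn_compact hK ?_).mono_set ?_
      · exact (hg.comp (by fun_prop)).continuousOn
      · exact Set.prod_mono Set.Ico_subset_Icc_self
          (Set.pi_mono fun _ _ => Set.Ico_subset_Icc_self)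

lemma aux_F {n : ℕ} (B : Matrix (Fin n) (Fin n) ℝ) (hB : IsUnit B.det)
    (ξ : Fin n → ℝ) (hξ0 : ξ ≠ 0)
    (hξ : ∀ e ∈ {e : Fin n → ℝ | ∃ m : Fin n → ℤ, e = B.mulVec fun i => (m i : ℝ)},
      ∃ k : ℤ, ∑ i, ξ i * e i = (k : ℝ))
    (g : ℝ → ℝ) (hg : Continuous g) (hp : Function.Periodic g 1) (d : ℝ) :
    ∫ x in B.mulVec '' Set.univ.pi fun _ : Fin n => Set.Ico (0 : ℝ) 1,
      g (∑ i, ξ i * x i + d) = |B.det| * ∫ y in (0 : ℝ)..1, g y := by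
  have hinj : Function.Injective B.mulVec :=
    Matrix.mulVec_injective_iff_isUnit.2 ((Matrix.isUnit_iff_isUnit_det B).2 hB)
  have h1 : ∀ j, ∃ k : ℤ, Matrix.vecMul ξ B j = k := by
    intro j
    obtain ⟨k, hk⟩ := hξ (B.mulVec fun i => ((Pi.single j (1 : ℤ) : Fin n → ℤ) i : ℝ)) ⟨_, rfl⟩
    refine ⟨k, ?_⟩
    rw [← hk]
    have : (fun i => ((Pi.single j (1 : ℤ) : Fin n → ℤ) i : ℝ)) = Pi.single j 1 := by
      ext i; by_cases h : i = j
      · subst h; simp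
      · simp [h]
    rw [this]
    simp [Matrix.vecMul, dotProduct]
  choose m hm using h1
  have hm0 : m ≠ 0 := by
    rintro rfl
    have : Matrix.vecMul ξ B = 0 := funext fun j => by simp [hm]
    have hi2 : Function.Injective B.vecMul :=
      Matrix.vecMul_injective_iff_isUnit.2 ((Matrix.isUnit_iff_isUnit_det B).2 hB)
    exact hξ0 (hi2 (by simpa using this))
  have hs : MeasurableSet (Set.univ.pi fun _ : Fin n => Set.Ico (0 : ℝ) 1) :=
    MeasurableSet.univ_pi fun _ => measurableSet_Ico
  have hdot : ∀ y, ∑ i, ξ i * B.mulVec y i = ∑ i, (m i : ℝ) * y i := by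
    intro y
    have := Matrix.dotProduct_mulVec ξ B y
    simp only [← hm]
    exact this
  have hder : ∀ x ∈ (Set.univ.pi fun _ : Fin n => Set.Ico (0 : ℝ) 1),
      HasFDerivWithinAt B.mulVec (LinearMap.toContinuousLinearMap (Matrix.toLin' B))
        (Set.univ.pi fun _ : Fin n => Set.Ico (0 : ℝ) 1) x := fun x _ =>
    (LinearMap.toContinuousLinearMap (Matrix.toLin' B)).hasFDerivWithinAt
  rw [integral_image_eq_integral_abs_det_fderiv_smul volume hs hder hinj.injOn]
  have hdet : (LinearMap.toContinuousLinearMap (Matrix.toLin' B)).det = B.det := by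
    rw [ContinuousLinearMap.det]; simp
  simp only [hdet, hdot, smul_eq_mul]
  rw [integral_const_mul, aux_cube g hg hp m hm0 d]

lemma aux_sin : ∫ s in (0 : ℝ)..1, Real.sin (2 * Real.pi * s) = 0 := by
  rw [intervalIntegral.integral_comp_mul_left _ (by positivity), integral_sin]
  simp

lemma aux_abs_sin : ∫ s in (0 : ℝ)..1, |Real.sin (2 * Real.pi * s)| = 2 / Real.pi := by
  rw [intervalIntegral.integral_comp_mul_left (fun x => |Real.sin x|) (by positivity)]
  have hc : Continuous fun x => |Real.sin x| := Real.continuous_sin.abs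
  have hp : Function.Periodic (fun x => |Real.sin x|) Real.pi := fun x => by simp
  have h1 : ∫ s in (0 : ℝ)..Real.pi, |Real.sin s| = 2 := by
    have h0 : ∫ s in (0 : ℝ)..Real.pi, Real.sin s = 2 := by
      rw [integral_sin]; norm_num
    rw [← h0]
    refine intervalIntegral.integral_congr fun x hx => ?_
    rw [Set.uIcc_of_le Real.pi_pos.le] at hx
    exact abs_of_nonneg (Real.sin_nonneg_of_mem_Icc hx)
  have h2 := hp.intervalIntegral_add_zsmul_eq 2 0 (fun _ _ => hc.intervalIntegrable _ _)
  simp only [zero_add, h1, zsmul_eq_mul] at h2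
  push_cast at h2
  rw [mul_zero, mul_one, h2, smul_eq_mul]
  field_simp

/-- If the non-degeneracy condition fails, i.e. `ξ·φ(λ) = αλ + β` on
`[I−δ, I+δ]` for some nonzero `ξ` in the dual lattice `L'`, then
`u(t,x) = I + δ sin(2π(ξ·x − αt))` is an `L`-periodic entropy solution with mean value `I`
whose deviation `∫_F |u(t,x) − I| dx` equals the positive constant `(2/π) δ |det B|` for
all `t > 0`; in particular it does not tend to `0` as `t → +∞`. -/
theorem nondecaying_periodic_entropy_solution
    (n : ℕ) (hn : 1 ≤ n) (B : Matrix (Fin n) (Fin n) ℝ) (hB : IsUnit B.det)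
    (L L' F : Set (Fin n → ℝ))
    (hL : L = {e | ∃ m : Fin n → ℤ, e = B.mulVec fun i => (m i : ℝ)})
    (hL' : L' = {ξ | ∀ e ∈ L, ∃ k : ℤ, ∑ i, ξ i * e i = (k : ℝ)})
    (hF : F = B.mulVec '' Set.univ.pi fun _ : Fin n => Set.Ico (0 : ℝ) 1)
    (φ : ℝ → Fin n → ℝ) (hφ : Continuous φ)
    (ξ : Fin n → ℝ) (hξL' : ξ ∈ L') (hξ0 : ξ ≠ (0 : Fin n → ℝ))
    (α β I δ : ℝ) (hδ : 0 < δ)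
    (haff : ∀ l ∈ Set.Icc (I - δ) (I + δ), ∑ i, ξ i * φ l i = α * l + β)
    (u : ℝ × (Fin n → ℝ) → ℝ)
    (hu : u = fun z => I + δ * Real.sin (2 * Real.pi * ((∑ i, ξ i * z.2 i) - α * z.1))) :
    IsEntropySolution n φ u ∧
    (∀ e ∈ L, ∀ t : ℝ, ∀ x : Fin n → ℝ, u (t, x + e) = u (t, x)) ∧
    (∀ t : ℝ, 0 < t → (1 / |B.det|) * ∫ x in F, u (t, x) = I) ∧
    (∀ t : ℝ, 0 < t → ∫ x in F, |u (t, x) - I| = 2 / Real.pi * δ * |B.det|) ∧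
    ¬ Tendsto (fun t => ∫ x in F, |u (t, x) - I|) atTop (nhds 0) := by
  subst hu hF hL' hL
  have hent := aux_entropy φ hφ ξ hξ0 α β I δ hδ haff
  have hsp : ∀ s : ℝ, ∀ k : ℤ, Real.sin (2 * Real.pi * (s + k)) = Real.sin (2 * Real.pi * s) := by
    intro s k
    rw [show 2 * Real.pi * (s + k) = 2 * Real.pi * s + k * (2 * Real.pi) by ring]
    exact Real.sin_add_int_mul_two_pi _ _
  have hsp1 : ∀ s : ℝ, Real.sin (2 * Real.pi * (s + 1)) = Real.sin (2 * Real.pi * s) := by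
    intro s
    simpa using hsp s 1
  have hdetpos : 0 < |B.det| := abs_pos.2 hB.ne_zero
  have hdev : ∀ t : ℝ, ∫ x in B.mulVec '' Set.univ.pi fun _ : Fin n => Set.Ico (0 : ℝ) 1,
      |(I + δ * Real.sin (2 * Real.pi * ((∑ i, ξ i * x i) - α * t))) - I|
        = 2 / Real.pi * δ * |B.det| := by
    intro t
    have := aux_F B hB ξ hξ0 hξL' (fun s => δ * |Real.sin (2 * Real.pi * s)|)
      (by fun_prop) (fun s => by simp only [hsp1]) (-(α * t))
    rw [intervalIntegral.integral_const_mul, aux_abs_sin] at this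
    simp only [add_sub_cancel_left, abs_mul, abs_of_pos hδ]
    simp only [← sub_eq_add_neg] at this
    rw [this]; ring
  refine ⟨hent, ?_, ?_, fun t _ => hdev t, ?_⟩
  · intro e he t x
    obtain ⟨k, hk⟩ := hξL' e he
    simp only [Pi.add_apply, mul_add, Finset.sum_add_distrib, hk]
    rw [← hsp ((∑ i, ξ i * x i) - α * t) k]
    ring_nf
  · intro t _
    have := aux_F B hB ξ hξ0 hξL' (fun s => I + δ * Real.sin (2 * Real.pi * s))
      (by fun_prop) (fun s => by simp only [hsp1]) (-(α * t))
    rw [intervalIntegral.integral_add (by simp)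
      (Continuous.intervalIntegrable (by fun_prop) _ _),
      intervalIntegral.integral_const_mul, aux_sin] at this
    simp only [← sub_eq_add_neg] at this
    simp only [this]
    simp
    field_simp
  · intro h
    simp only [hdev] at h
    have h0 := tendsto_nhds_unique h tendsto_const_nhds
    have : 0 < 2 / Real.pi * δ * |B.det| := by positivity
    linarith
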